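/- Let V be a finite-dimensional real inner product space and let p ≥ 2. Then for every x, y ∈ V it holds that |x|^p + (p-1)|y|^p ≥ p|y|^{p-2}⟨x,y⟩ + (1/(2^{p-1}-1))|x-y|^p. -/

import Mathlib

open scoped RealInnerProductSpace

theorem aux_clarkson {V : Type*} [NormedAddCommGroup V] [InnerProductSpace ℝ V]
    (p : ℝ) (hp : 2 ≤ p) (x y : V) :
    2 * ‖(1/2 : ℝ) • (x + y)‖ ^ p + 2 * ‖(1/2 : ℝ) • (x - y)‖ ^ p ≤ ‖x‖ ^ p + ‖y‖ ^ p := by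
  have key : ∀ a : ℝ, 0 ≤ a → (a ^ 2) ^ (p / 2) = a ^ p := by
    intro a ha
    rw [← Real.rpow_natCast, ← Real.rpow_mul ha]
    congr 1
    push_cast
    ring
  have h1 := Real.add_rpow_le_rpow_add (sq_nonneg ‖(1/2 : ℝ) • (x + y)‖)
    (sq_nonneg ‖(1/2 : ℝ) • (x - y)‖) (p := p / 2) (by linarith)
  have h2 := (convexOn_rpow (p := p / 2) (by linarith)).2
    (Set.mem_Ici.2 (sq_nonneg ‖x‖)) (Set.mem_Ici.2 (sq_nonneg ‖y‖))
    (show (0 : ℝ) ≤ 1/2 by norm_num) (show (0 : ℝ) ≤ 1/2 by norm_num) (by norm_num)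
  simp only [smul_eq_mul] at h2
  have h3 : ‖(1/2 : ℝ) • (x + y)‖ ^ 2 + ‖(1/2 : ℝ) • (x - y)‖ ^ 2
      = 1/2 * ‖x‖ ^ 2 + 1/2 * ‖y‖ ^ 2 := by
    rw [norm_smul, norm_smul, mul_pow, mul_pow, norm_add_sq_real, norm_sub_sq_real]
    norm_num
    ring
  rw [h3, key _ (norm_nonneg _), key _ (norm_nonneg _)] at h1
  rw [key _ (norm_nonneg _), key _ (norm_nonneg _)] at h2
  linarith

theorem aux_base {V : Type*} [NormedAddCommGroup V] [InnerProductSpace ℝ V]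
    (p : ℝ) (hp : 2 ≤ p) (x y : V) :
    p * ‖y‖ ^ (p - 2) * ⟪x, y⟫ ≤ ‖x‖ ^ p + (p - 1) * ‖y‖ ^ p := by
  have hpos : 0 < p := by linarith
  have hpq : p.HolderConjugate (p / (p - 1)) := Real.HolderConjugate.conjExponent (by linarith)
  have h := Real.young_inequality_of_nonneg (norm_nonneg x)
    (Real.rpow_nonneg (norm_nonneg y) (p - 1)) hpq
  have hne : p - 1 ≠ 0 := by linarith
  rw [← Real.rpow_mul (norm_nonneg y), mul_div_cancel₀ _ hne] at h
  have h2 : ‖y‖ ^ (p - 1) = ‖y‖ ^ (p - 2) * ‖y‖ := by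
    have := Real.rpow_add_of_nonneg (norm_nonneg y) (y := p - 2) (z := 1)
      (by linarith) (by norm_num)
    rw [Real.rpow_one] at this
    rw [← this]
    congr 1
    ring
  have h3 := mul_le_mul_of_nonneg_left (real_inner_le_norm x y)
    (mul_nonneg hpos.le (Real.rpow_nonneg (norm_nonneg y) (p - 2)))
  have h4 := mul_le_mul_of_nonneg_left h hpos.le
  have h5 : p * (‖x‖ ^ p / p + ‖y‖ ^ p / (p / (p - 1))) = ‖x‖ ^ p + (p - 1) * ‖y‖ ^ p := by
    field_simp
  rw [h5, h2] at h4
  linarith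

theorem aux_iter {V : Type*} [NormedAddCommGroup V] [InnerProductSpace ℝ V]
    (p : ℝ) (hp : 2 ≤ p) (y : V) (n : ℕ) : ∀ x : V,
    p * ‖y‖ ^ (p - 2) * ⟪x, y⟫ + (1 / ((2 : ℝ) ^ (p - 1) - 1)) *
      (1 - (((2 : ℝ) ^ (p - 1))⁻¹) ^ n) * ‖x - y‖ ^ p ≤ ‖x‖ ^ p + (p - 1) * ‖y‖ ^ p := by
  induction n with
  | zero =>
    intro x
    simpa using aux_base p hp x y
  | succ n ih =>
    intro x
    have h := ih ((1/2 : ℝ) • (x + y))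
    have hc := aux_clarkson p hp x y
    have e1 : (1/2 : ℝ) • (x + y) - y = (1/2 : ℝ) • (x - y) := by
      module
    have hT : (2 : ℝ) ≤ (2 : ℝ) ^ (p - 1) := by
      simpa using Real.rpow_le_rpow_of_exponent_le (x := 2) (by norm_num)
        (show (1 : ℝ) ≤ p - 1 by linarith)
    have e2 : ‖x - y‖ ^ p = 2 * (2 : ℝ) ^ (p - 1) * ‖(1/2 : ℝ) • (x - y)‖ ^ p := by
      have e : (2 : ℝ) * (2 : ℝ) ^ (p - 1) = 2 ^ p := by
        rw [Real.rpow_sub_one (by norm_num)]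
        ring
      rw [e, ← Real.mul_rpow (by norm_num) (norm_nonneg _), norm_smul]
      congr 1
      norm_num
      ring
    have e3 : ⟪(1/2 : ℝ) • (x + y), y⟫ = (⟪x, y⟫ + ‖y‖ ^ 2) / 2 := by
      rw [real_inner_smul_left, inner_add_left, real_inner_self_eq_norm_sq]
      ring
    have e4 : ‖y‖ ^ (p - 2) * ‖y‖ ^ 2 = ‖y‖ ^ p := by
      rw [← Real.rpow_natCast, ← Real.rpow_add_of_nonneg (norm_nonneg y) (by linarith)
        (by norm_num)]
      congr 1
      push_cast
      ring
    rw [e1, e3] at h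
    rw [e2]
    generalize ‖(1/2 : ℝ) • (x - y)‖ ^ p = v at *
    generalize (2 : ℝ) ^ (p - 1) = T at *
    have e5 : (1 / (T - 1)) * (1 - (T⁻¹) ^ (n + 1)) * (2 * T * v)
        = 2 * ((1 / (T - 1)) * (1 - (T⁻¹) ^ n) * v) + 2 * v := by
      have h1 : T ≠ 0 := by linarith
      have h2 : T - 1 ≠ 0 := by linarith
      rw [pow_succ]
      generalize T⁻¹ ^ n = r
      field_simp
      ring
    rw [e5]
    have e6 : p * ‖y‖ ^ (p - 2) * ((⟪x, y⟫ + ‖y‖ ^ 2) / 2)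
        = (p * ‖y‖ ^ (p - 2) * ⟪x, y⟫ + p * ‖y‖ ^ p) / 2 := by
      rw [← e4]
      ring
    rw [e6] at h
    linarith

/-- Lindqvist's inequality: for `p ≥ 2` and `x, y` in a finite-dimensional real inner
product space, `|x|^p + (p-1)|y|^p ≥ p|y|^{p-2}⟨x,y⟩ + (1/(2^{p-1}-1))|x-y|^p`. -/
theorem lindqvist_inequality
    {V : Type*} [NormedAddCommGroup V] [InnerProductSpace ℝ V] [FiniteDimensional ℝ V]
    (p : ℝ) (hp : 2 ≤ p) (x y : V) :
    ‖x‖ ^ p + (p - 1) * ‖y‖ ^ p ≥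
      p * ‖y‖ ^ (p - 2) * ⟪x, y⟫ + (1 / ((2 : ℝ) ^ (p - 1) - 1)) * ‖x - y‖ ^ p := by
  have hT : (2 : ℝ) ≤ (2 : ℝ) ^ (p - 1) := by
    simpa using Real.rpow_le_rpow_of_exponent_le (x := 2) (by norm_num)
      (show (1 : ℝ) ≤ p - 1 by linarith)
  have hl := tendsto_pow_atTop_nhds_zero_of_lt_one (r := ((2 : ℝ) ^ (p - 1))⁻¹)
    (by positivity) (inv_lt_one_of_one_lt₀ (by linarith))
  have hl2 := (((hl.const_sub 1).const_mul (1 / ((2 : ℝ) ^ (p - 1) - 1))).mul_const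
    (‖x - y‖ ^ p)).const_add (p * ‖y‖ ^ (p - 2) * ⟪x, y⟫)
  rw [sub_zero, mul_one] at hl2
  exact le_of_tendsto' hl2 (fun n => aux_iter p hp y n x)
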